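/- Let C be a deflation quasi-abelian category. Call an object X of C Noetherian if every ascending chain of subobjects of X is stationary (the poset of subobjects of X satisfies the ascending chain condition). Then for every kernel-cokernel pair X →f Y →g Z in C (f a kernel of g and g a cokernel of f), the object Y is Noetherian if and only if both X and Z are Noetherian. In particular, the full subcategory of Noetherian objects is a Serre subcategory of C. -/

import Mathlib

open CategoryTheory CategoryTheory.Limits

universe v u

namespace GliderPaper

/-- An object is Noetherian if its subobject poset satisfies the ascending chain
condition, i.e. is well-founded for `>`. -/
def NoetherianObj {C : Type u} [Category.{v} C] (X : C) : Prop :=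
  WellFoundedGT (Subobject X)

/-- Normal epimorphisms are stable under pullback. -/
def NormalEpiStable (C : Type u) [Category.{v} C] [Preadditive C] : Prop :=
  ∀ {P X Y Z : C} (fst : P ⟶ X) (snd : P ⟶ Y) (f : X ⟶ Z) (g : Y ⟶ Z),
    IsPullback fst snd f g → Nonempty (NormalEpi g) → Nonempty (NormalEpi fst)

lemma Subobject.le_of_strongEpi_of_factors {C : Type u} [Category.{v} C] {W Y : C}
    {S T : Subobject Y} (e : W ⟶ (T : C)) [StrongEpi e]
    (h : S.Factors (e ≫ T.arrow)) : T ≤ S := by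
  have sq : CommSq (S.factorThru _ h) e S.arrow T.arrow := ⟨by simp⟩
  exact Subobject.le_of_comm sq.lift sq.fac_right

section

variable {C : Type u} [Category.{v} C] [Preadditive C]

lemma strongEpi_of_normalEpi {X Y : C} {e : X ⟶ Y} (h : Nonempty (NormalEpi e)) :
    StrongEpi e := by
  obtain ⟨h⟩ := h
  have : IsRegularEpi e := ⟨⟨h.regularEpi⟩⟩
  infer_instance

variable [HasKernels C] [HasCokernels C]

lemma nonempty_normalEpi_coimage_π {X Y : C} (h : X ⟶ Y) :
    Nonempty (NormalEpi (Abelian.coimage.π h)) :=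
  ⟨{ W := kernel h
     g := kernel.ι h
     w := cokernel.condition _
     isColimit := cokernelIsCokernel _ }⟩

/-- The comparison morphism from the coimage is a monomorphism. -/
lemma mono_factorThruCoimage [HasPullbacks C] (hC : NormalEpiStable C) {X Y : C} (h : X ⟶ Y) :
    Mono (Abelian.factorThruCoimage h) := by
  refine Preadditive.mono_of_cancel_zero _ fun {K} k hk => ?_
  have := strongEpi_of_normalEpi
    (hC _ _ _ _ (IsPullback.of_hasPullback k (Abelian.coimage.π h))
      (nonempty_normalEpi_coimage_π h))
  rw [← cancel_epi (pullback.fst k (Abelian.coimage.π h)), comp_zero, pullback.condition]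
  have hz : pullback.snd k (Abelian.coimage.π h) ≫ h = 0 := by
    have hf := pullback.snd k (Abelian.coimage.π h) ≫= Abelian.coimage.fac h
    rw [← hf, ← Category.assoc, ← pullback.condition, Category.assoc, hk, comp_zero]
  rw [← kernel.lift_ι h _ hz, Category.assoc, cokernel.condition, comp_zero]

lemma hasStrongEpiMonoFactorisations [HasPullbacks C] (hC : NormalEpiStable C) :
    HasStrongEpiMonoFactorisations C :=
  HasStrongEpiMonoFactorisations.mk fun h =>
    { I := Abelian.coimage h
      m := Abelian.factorThruCoimage h
      m_mono := mono_factorThruCoimage hC h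
      e := Abelian.coimage.π h
      fac := Abelian.coimage.fac h
      e_strong_epi := strongEpi_of_normalEpi (nonempty_normalEpi_coimage_π h) }

lemma normalEpi_of_strongEpi [HasPullbacks C] (hC : NormalEpiStable C) {X Y : C} (e : X ⟶ Y)
    [StrongEpi e] : Nonempty (NormalEpi e) := by
  have := mono_factorThruCoimage hC e
  have : StrongEpi (Abelian.coimage.π e ≫ Abelian.factorThruCoimage e) := by
    rw [Abelian.coimage.fac]; infer_instance
  have := strongEpi_of_strongEpi (Abelian.coimage.π e) (Abelian.factorThruCoimage e)
  have := isIso_of_mono_of_strongEpi (Abelian.factorThruCoimage e)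
  exact ⟨{ W := kernel e
           g := kernel.ι e
           w := kernel.condition e
           isColimit := IsColimit.ofIsoColimit (cokernelIsCokernel (kernel.ι e))
            (Cofork.ext (asIso (Abelian.factorThruCoimage e)) (Abelian.coimage.fac e)) }⟩

lemma strongEpi_snd [HasPullbacks C] (hC : NormalEpiStable C) {X Y Z : C} (q : X ⟶ Z)
    (p : Y ⟶ Z) [StrongEpi q] : StrongEpi (pullback.snd q p) :=
  strongEpi_of_normalEpi
    (hC _ _ _ _ (IsPullback.of_hasPullback q p).flip (normalEpi_of_strongEpi hC q))

lemma strictMono_pullback_of_strongEpi [HasPullbacks C] (hC : NormalEpiStable C) {Y Z : C}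
    (g : Y ⟶ Z) [StrongEpi g] : StrictMono (Subobject.pullback g).obj := by
  intro S T hST
  refine lt_of_le_not_ge ((Subobject.pullback g).monotone hST.le) fun h => hST.not_ge ?_
  have : StrongEpi (Subobject.pullbackπ g T) :=
    strongEpi_of_normalEpi
      (hC _ _ _ _ (Subobject.isPullback g T) (normalEpi_of_strongEpi hC g))
  refine Subobject.le_of_strongEpi_of_factors (Subobject.pullbackπ g T) ?_
  rw [(Subobject.isPullback g T).w, ← Limits.pullback_factors_iff]
  exact Subobject.factors_of_le _ h (Subobject.factors_self _)

/-- Nested subobjects are compared by their intersections with the kernel of `g` and their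
images under `g`. -/
lemma le_of_pullback_le_of_image_le [HasPullbacks C] [HasEqualizers C] [HasImages C]
    (hC : NormalEpiStable C)
    {X Y Z : C} {f : X ⟶ Y} {g : Y ⟶ Z} (w : f ≫ g = 0) (hker : IsLimit (KernelFork.ofι f w))
    {S T : Subobject Y} (hST : S ≤ T)
    (hX : (Subobject.pullback f).obj T ≤ (Subobject.pullback f).obj S)
    (hZ : imageSubobject (T.arrow ≫ g) ≤ imageSubobject (S.arrow ≫ g)) : T ≤ S := by
  have := hasStrongEpiMonoFactorisations hC
  let q := factorThruImageSubobject (S.arrow ≫ g)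
  let p := factorThruImageSubobject (T.arrow ≫ g) ≫ Subobject.ofLE _ _ hZ
  have : StrongEpi q := by dsimp only [q, factorThruImageSubobject]; infer_instance
  have : StrongEpi (pullback.snd q p) := strongEpi_snd hC q p
  refine Subobject.le_of_strongEpi_of_factors (pullback.snd q p) ?_
  let a := pullback.fst q p ≫ S.arrow
  let b := pullback.snd q p ≫ T.arrow
  have hab : (b - a) ≫ g = 0 := by
    have h := pullback.condition (f := q) (g := p) =≫ (imageSubobject (S.arrow ≫ g)).arrow
    simp only [q, p, Category.assoc, Subobject.ofLE_arrow, imageSubobject_arrow_comp] at h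
    simpa [a, b, Preadditive.sub_comp, sub_eq_zero] using h.symm
  obtain ⟨l, hl⟩ := KernelFork.IsLimit.lift' hker _ hab
  have hl : l ≫ f = b - a := hl
  have hT : T.Factors (b - a) :=
    Subobject.factors_left_of_factors_add _ a
      (by simpa only [sub_add_cancel] using Subobject.factors_comp_arrow _)
      (Subobject.factors_of_le _ hST (Subobject.factors_comp_arrow _))
  rw [← hl, ← Limits.pullback_factors_iff] at hT
  have hS := Subobject.factors_of_le _ hX hT
  rw [Limits.pullback_factors_iff, hl] at hS
  have := Subobject.factors_add _ _ hS
    (Subobject.factors_comp_arrow (P := S) (pullback.fst q p))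
  rwa [sub_add_cancel] at this

end

/-- Let `C` be a deflation quasi-abelian category: a pre-abelian
category (an additive category with kernels and cokernels) in which cokernels are
stable under pullback (the pullback of a normal epimorphism along any morphism is again
a normal epimorphism).  Then for every kernel-cokernel pair `X ⟶f Y ⟶g Z` in `C`
(`f` a kernel of `g` and `g` a cokernel of `f`), the object `Y` is Noetherian if and
only if both `X` and `Z` are Noetherian.  (In particular the full subcategory of
Noetherian objects is a Serre subcategory of `C`.) -/
theorem statement_16 {C : Type u} [Category.{v} C] [Preadditive C] [HasFiniteProducts C]
    [HasKernels C] [HasCokernels C]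
    (hpb : ∀ {P X Y Z : C} (fst : P ⟶ X) (snd : P ⟶ Y) (f : X ⟶ Z) (g : Y ⟶ Z),
      IsPullback fst snd f g → Nonempty (NormalEpi g) → Nonempty (NormalEpi fst))
    {X Y Z : C} (f : X ⟶ Y) (g : Y ⟶ Z) (w : f ≫ g = 0)
    (hker : Nonempty (IsLimit (KernelFork.ofι f w)))
    (hcoker : Nonempty (IsColimit (CokernelCofork.ofπ g w))) :
    NoetherianObj Y ↔ (NoetherianObj X ∧ NoetherianObj Z) := by
  have : HasEqualizers C := Preadditive.hasEqualizers_of_hasKernels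
  have : HasFiniteLimits C := hasFiniteLimits_of_hasEqualizers_and_finite_products
  have hC : NormalEpiStable C := hpb
  have := hasStrongEpiMonoFactorisations hC
  obtain ⟨hker⟩ := hker
  obtain ⟨hcoker⟩ := hcoker
  have : Mono f := mono_of_isLimit_fork hker
  have : StrongEpi g := strongEpi_of_normalEpi ⟨⟨X, f, w, hcoker⟩⟩
  unfold NoetherianObj
  constructor
  · intro _
    exact ⟨((Subobject.map f).monotone.strictMono_of_injective
        (Subobject.map_obj_injective f)).wellFoundedGT,
      (strictMono_pullback_of_strongEpi hC g).wellFoundedGT⟩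
  · rintro ⟨_, _⟩
    refine StrictMono.wellFoundedGT
      (f := fun S : Subobject Y =>
        ((Subobject.pullback f).obj S, imageSubobject (S.arrow ≫ g))) fun S T hST => ?_
    refine lt_of_le_not_ge ⟨(Subobject.pullback f).monotone hST.le, ?_⟩ fun h =>
      hST.not_ge (le_of_pullback_le_of_image_le hC w hker hST.le h.1 h.2)
    have h : imageSubobject (S.arrow ≫ g) =
        imageSubobject (Subobject.ofLE S T hST.le ≫ T.arrow ≫ g) := by
      rw [Subobject.ofLE_arrow_assoc]
    exact h.trans_le (imageSubobject_comp_le _ _)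

end GliderPaper
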